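/- Let n > 2 be an integer and let R be a de Groot continuum with two distinguished points b₁ ≠ b₂. Let X be the quotient space of (ℤ/nℤ) × R by the equivalence relation generated by (m+1, b₁) ~ (m, b₂) for all m ∈ ℤ/nℤ. Then X is a compact connected Hausdorff space, and the map sending each m ∈ ℤ/nℤ to the self-homeomorphism of X induced by (k, x) ↦ (m+k, x) is a group isomorphism from ℤ/nℤ onto the group H(X) of all self-homeomorphisms of X. -/

import Mathlib

/-- The group of self-homeomorphisms of a topological space, under composition. -/
instance homeomorphGroup (X : Type*) [TopologicalSpace X] : Group (X ≃ₜ X) where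
  mul f g := g.trans f
  one := Homeomorph.refl X
  inv := Homeomorph.symm
  mul_assoc _ _ _ := Homeomorph.ext fun _ => rfl
  one_mul _ := Homeomorph.ext fun _ => rfl
  mul_one _ := Homeomorph.ext fun _ => rfl
  inv_mul_cancel f := Homeomorph.ext fun x => f.symm_apply_apply x

/-- The relation on `(ℤ/nℤ) × R` identifying `(m+1, b₁)` with `(m, b₂)`. -/
def cycleRel (n : ℕ) (R : Type) (b₁ b₂ : R) : ZMod n × R → ZMod n × R → Prop :=
  fun p q => p.1 = q.1 + 1 ∧ p.2 = b₁ ∧ q.2 = b₂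

/-- A closed continuous surjection maps a normal space onto a Hausdorff space if its codomain
has closed points. -/
theorem IsClosedMap.t2Space_of_surjective {X Y : Type*} [TopologicalSpace X] [TopologicalSpace Y]
    [NormalSpace X] [T1Space Y] {f : X → Y} (hf : IsClosedMap f) (hcont : Continuous f)
    (hsurj : Function.Surjective f) : T2Space Y := by
  refine ⟨fun a b hab => ?_⟩
  obtain ⟨U, V, hU, hV, hUa, hVb, hUV⟩ := normal_separation
    ((isClosed_singleton (x := a)).preimage hcont) ((isClosed_singleton (x := b)).preimage hcont)
    ((Set.disjoint_singleton.2 hab).preimage f)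
  refine ⟨(f '' Uᶜ)ᶜ, (f '' Vᶜ)ᶜ, (hf _ hU.isClosed_compl).isOpen_compl,
    (hf _ hV.isClosed_compl).isOpen_compl, ?_, ?_, ?_⟩
  · rintro ⟨x, hx, rfl⟩
    exact hx (hUa rfl)
  · rintro ⟨x, hx, rfl⟩
    exact hx (hVb rfl)
  · rw [Set.disjoint_left]
    intro y hyU hyV
    obtain ⟨x, rfl⟩ := hsurj y
    have hxU : x ∈ U := by
      by_contra h
      exact hyU ⟨x, h, rfl⟩
    have hxV : x ∈ V := by
      by_contra h
      exact hyV ⟨x, h, rfl⟩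
    exact Set.disjoint_left.1 hUV hxU hxV

/-- A rigid connected space has no cut points: if two closed sets cover it and meet in at most
one point, one of them is everything. -/
theorem eq_univ_or_eq_univ_of_rigid {R : Type*} [TopologicalSpace R] [PreconnectedSpace R]
    (hrigid : ∀ f : R → R, Continuous f → f = id ∨ ∃ c, f = Function.const R c)
    {S T : Set R} (hS : IsClosed S) (hT : IsClosed T) (hST : S ∪ T = Set.univ)
    (hsub : (S ∩ T).Subsingleton) : S = Set.univ ∨ T = Set.univ := by
  classical
  have hcov (x : R) : x ∈ S ∨ x ∈ T := by
    simpa using Set.ext_iff.1 hST x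
  rcases S.eq_empty_or_nonempty with rfl | hSne
  · exact Or.inr (by simpa using hST)
  rcases T.eq_empty_or_nonempty with rfl | hTne
  · exact Or.inl (by simpa using hST)
  obtain ⟨q, -, hqS, hqT⟩ := isPreconnected_closed_iff.1 isPreconnected_univ S T hS hT
    hST.ge (by simpa using hSne) (by simpa using hTne)
  let f : R → R := fun x => if x ∈ S then x else q
  have hfS (x : R) (hx : x ∈ S) : f x = x := if_pos hx
  have hfT (x : R) (hx : x ∈ T) : f x = q := by
    by_cases h : x ∈ S
    · rw [hfS x h]
      exact hsub ⟨h, hx⟩ ⟨hqS, hqT⟩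
    · exact if_neg h
  have hcont : Continuous f := by
    rw [← continuousOn_univ, ← hST]
    exact (continuousOn_id.congr hfS).union_of_isClosed (continuousOn_const.congr hfT) hS hT
  rcases hrigid f hcont with hid | ⟨c, hc⟩
  · refine Or.inl (Set.eq_univ_of_forall fun x => (hcov x).elim id fun hx => ?_)
    have : x = q := by rw [← hfT x hx, hid, id]
    exact this ▸ hqS
  · refine Or.inr (Set.eq_univ_of_forall fun x => (hcov x).elim (fun hx => ?_) id)
    have : x = q := by
      rw [← hfS x hx, ← hfT q hqT, hc, Function.const_apply, Function.const_apply]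
    exact this ▸ hqT

section CycleRealisation

variable {n : ℕ} {R : Type} {b₁ b₂ : R}

/-- The inclusion of the `m`-th copy of `R` in the realisation of the cycle. -/
def cycleInclusion (n : ℕ) (b₁ b₂ : R) (m : ZMod n) (x : R) : Quot (cycleRel n R b₁ b₂) :=
  Quot.mk _ (m, x)

theorem exists_cycleInclusion_eq (a : Quot (cycleRel n R b₁ b₂)) :
    ∃ m x, cycleInclusion n b₁ b₂ m x = a := by
  induction a using Quot.ind with
  | mk p => exact ⟨p.1, p.2, rfl⟩

theorem cycleInclusion_glue (m : ZMod n) :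
    cycleInclusion n b₁ b₂ (m + 1) b₁ = cycleInclusion n b₁ b₂ m b₂ :=
  Quot.sound ⟨rfl, rfl, rfl⟩

theorem cycleInclusion_eq_iff (hb : b₁ ≠ b₂) {k l : ZMod n} {x y : R} :
    cycleInclusion n b₁ b₂ k x = cycleInclusion n b₁ b₂ l y ↔
      (k = l ∧ x = y) ∨ (k = l + 1 ∧ x = b₁ ∧ y = b₂) ∨ (l = k + 1 ∧ y = b₁ ∧ x = b₂) := by
  constructor
  · intro h
    let E : ZMod n × R → ZMod n × R → Prop := fun p q =>
      (p.1 = q.1 ∧ p.2 = q.2) ∨ cycleRel n R b₁ b₂ p q ∨ cycleRel n R b₁ b₂ q p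
    have hE : Equivalence E := by
      refine ⟨fun p => Or.inl ⟨rfl, rfl⟩, fun {p q} hpq => ?_, fun {p q s} hpq hqs => ?_⟩
      · simp only [E, cycleRel] at *
        grind
      · simp only [E, cycleRel] at *
        grind
    exact hE.eqvGen_iff.1 ((Quot.eqvGen_exact h).mono fun _ _ h => Or.inr (Or.inl h))
  · rintro (⟨rfl, rfl⟩ | ⟨rfl, rfl, rfl⟩ | ⟨rfl, rfl, rfl⟩)
    · rfl
    · exact cycleInclusion_glue l
    · exact (cycleInclusion_glue k).symm

theorem cycleInclusion_injective (hn : 2 < n) (hb : b₁ ≠ b₂) (m : ZMod n) :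
    Function.Injective (cycleInclusion n b₁ b₂ m) := by
  have : Fact (1 < n) := ⟨by omega⟩
  intro x y h
  rcases (cycleInclusion_eq_iff hb).1 h with h | h | h
  · exact h.2
  · simp at h
  · simp at h

/-- Rotation of the realisation of the cycle by `m` steps. -/
def cycleRotate (n : ℕ) (b₁ b₂ : R) (m : ZMod n) :
    Quot (cycleRel n R b₁ b₂) → Quot (cycleRel n R b₁ b₂) :=
  Quot.map (fun p => (m + p.1, p.2)) fun _ _ h => ⟨by simp only [h.1, add_assoc], h.2⟩

theorem cycleRotate_cycleInclusion (m k : ZMod n) (x : R) :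
    cycleRotate n b₁ b₂ m (cycleInclusion n b₁ b₂ k x) = cycleInclusion n b₁ b₂ (m + k) x :=
  rfl

theorem cycleRotate_cycleRotate (m k : ZMod n) (a : Quot (cycleRel n R b₁ b₂)) :
    cycleRotate n b₁ b₂ m (cycleRotate n b₁ b₂ k a) = cycleRotate n b₁ b₂ (m + k) a := by
  obtain ⟨l, x, rfl⟩ := exists_cycleInclusion_eq a
  simp only [cycleRotate_cycleInclusion, add_assoc]

theorem cycleRotate_zero (a : Quot (cycleRel n R b₁ b₂)) : cycleRotate n b₁ b₂ 0 a = a := by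
  obtain ⟨l, x, rfl⟩ := exists_cycleInclusion_eq a
  simp only [cycleRotate_cycleInclusion, zero_add]

/-- The union of the copies of `R` indexed by `S`. -/
def cyclePart (b₁ b₂ : R) (S : Set (ZMod n)) : Set (Quot (cycleRel n R b₁ b₂)) :=
  Quot.mk _ '' (Prod.fst ⁻¹' S)

theorem mem_cyclePart {S : Set (ZMod n)} {a : Quot (cycleRel n R b₁ b₂)} :
    a ∈ cyclePart b₁ b₂ S ↔ ∃ k ∈ S, ∃ x, cycleInclusion n b₁ b₂ k x = a := by
  constructor
  · rintro ⟨⟨k, x⟩, hk, rfl⟩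
    exact ⟨k, hk, x, rfl⟩
  · rintro ⟨k, hk, x, rfl⟩
    exact ⟨(k, x), hk, rfl⟩

theorem cyclePart_union_compl (S : Set (ZMod n)) :
    cyclePart b₁ b₂ S ∪ cyclePart b₁ b₂ Sᶜ = Set.univ := by
  rw [cyclePart, cyclePart, ← Set.image_union, Set.preimage_compl, Set.union_compl_self,
    Set.image_univ, Quot.mk_surjective.range_eq]

theorem exists_of_mem_cyclePart_inter_compl (hb : b₁ ≠ b₂) {S : Set (ZMod n)}
    {a : Quot (cycleRel n R b₁ b₂)} (h : a ∈ cyclePart b₁ b₂ S) (h' : a ∈ cyclePart b₁ b₂ Sᶜ) :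
    ∃ k, a = cycleInclusion n b₁ b₂ k b₂ ∧ (k ∈ S ↔ k + 1 ∉ S) := by
  obtain ⟨k, hk, x, rfl⟩ := mem_cyclePart.1 h
  obtain ⟨l, hl, y, hy⟩ := mem_cyclePart.1 h'
  rcases (cycleInclusion_eq_iff hb).1 hy with ⟨rfl, rfl⟩ | ⟨rfl, rfl, rfl⟩ | ⟨rfl, rfl, rfl⟩
  · exact absurd hk hl
  · exact ⟨k, rfl, by simpa [hk] using hl⟩
  · exact ⟨l, cycleInclusion_glue l, by simpa [hk] using hl⟩

variable [TopologicalSpace R]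

theorem continuous_cycleInclusion (m : ZMod n) : Continuous (cycleInclusion n b₁ b₂ m) :=
  continuous_quot_mk.comp (Continuous.prodMk_right m)

theorem continuous_cycleRotate (m : ZMod n) : Continuous (cycleRotate n b₁ b₂ m) :=
  continuous_quot_lift _ (continuous_quot_mk.comp
    (((continuous_of_discreteTopology (f := fun k => m + k)).comp continuous_fst).prodMk
      continuous_snd))

/-- Rotation by `m` steps as a self-homeomorphism. -/
def cycleRotation (n : ℕ) (b₁ b₂ : R) (m : ZMod n) :
    Quot (cycleRel n R b₁ b₂) ≃ₜ Quot (cycleRel n R b₁ b₂) where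
  toFun := cycleRotate n b₁ b₂ m
  invFun := cycleRotate n b₁ b₂ (-m)
  left_inv a := by rw [cycleRotate_cycleRotate, neg_add_cancel, cycleRotate_zero]
  right_inv a := by rw [cycleRotate_cycleRotate, add_neg_cancel, cycleRotate_zero]
  continuous_toFun := continuous_cycleRotate m
  continuous_invFun := continuous_cycleRotate (-m)

/-- Rotations as a homomorphism to the homeomorphism group. -/
def cycleRotationHom (n : ℕ) (b₁ b₂ : R) :
    Multiplicative (ZMod n) →* (Quot (cycleRel n R b₁ b₂) ≃ₜ Quot (cycleRel n R b₁ b₂)) where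
  toFun m := cycleRotation n b₁ b₂ m.toAdd
  map_one' := Homeomorph.ext cycleRotate_zero
  map_mul' m k := Homeomorph.ext fun a => (cycleRotate_cycleRotate m.toAdd k.toAdd a).symm

theorem isClosedMap_cycle_mk [NeZero n] [T1Space R] (hb : b₁ ≠ b₂) :
    IsClosedMap (Quot.mk (cycleRel n R b₁ b₂)) := by
  intro C hC
  have hfin : ({p : ZMod n × R | p.2 = b₁ ∨ p.2 = b₂}).Finite := by
    have hprod := (Set.finite_univ (α := ZMod n)).prod (Set.toFinite ({b₁, b₂} : Set R))
    exact hprod.subset fun p hp => ⟨trivial, hp⟩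
  have hpre : Quot.mk (cycleRel n R b₁ b₂) ⁻¹' (Quot.mk (cycleRel n R b₁ b₂) '' C) =
      C ∪ (Quot.mk (cycleRel n R b₁ b₂) ⁻¹' (Quot.mk (cycleRel n R b₁ b₂) '' C) ∩
        {p | p.2 = b₁ ∨ p.2 = b₂}) := by
    refine Set.Subset.antisymm ?_ (Set.union_subset (Set.subset_preimage_image _ _)
      Set.inter_subset_left)
    rintro ⟨l, y⟩ ⟨⟨k, x⟩, hC, h⟩
    rcases (cycleInclusion_eq_iff hb).1 h with ⟨rfl, rfl⟩ | h' | h'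
    · exact Or.inl hC
    · exact Or.inr ⟨⟨_, hC, h⟩, Or.inr h'.2.2⟩
    · exact Or.inr ⟨⟨_, hC, h⟩, Or.inl h'.2.1⟩
  rw [← isQuotientMap_quot_mk.isClosed_preimage, hpre]
  exact hC.union (hfin.subset Set.inter_subset_right).isClosed

theorem isClosed_cyclePart [NeZero n] [T1Space R] (hb : b₁ ≠ b₂) (S : Set (ZMod n)) :
    IsClosed (cyclePart b₁ b₂ S) :=
  isClosedMap_cycle_mk hb _ ((isClosed_discrete S).preimage continuous_fst)

theorem t2Space_cycle [NeZero n] [CompactSpace R] [T2Space R] (hb : b₁ ≠ b₂) :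
    T2Space (Quot (cycleRel n R b₁ b₂)) := by
  have hclosed := isClosedMap_cycle_mk (n := n) hb
  have : T1Space (Quot (cycleRel n R b₁ b₂)) := by
    refine ⟨fun a => ?_⟩
    obtain ⟨p, rfl⟩ := Quot.exists_rep a
    simpa using hclosed _ (isClosed_singleton (x := p))
  exact hclosed.t2Space_of_surjective continuous_quot_mk Quot.mk_surjective

theorem ZMod.forall_eq_add_of_succ [NeZero n] {σ : ZMod n → ZMod n}
    (h : ∀ m, σ (m + 1) = σ m + 1) (m : ZMod n) : σ m = σ 0 + m := by
  have key (j : ℕ) : σ j = σ 0 + j := by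
    induction j with
    | zero => simp
    | succ j ih => rw [Nat.cast_succ, h, ih, add_assoc]
  simpa using key m.val

theorem connectedSpace_cycle [NeZero n] [ConnectedSpace R] :
    ConnectedSpace (Quot (cycleRel n R b₁ b₂)) := by
  have : PreconnectedSpace (Quot (cycleRel n R b₁ b₂)) := by
    refine preconnectedSpace_of_forall_constant fun f hf => ?_
    have hcopy (m : ZMod n) (x y : R) :
        f (cycleInclusion n b₁ b₂ m x) = f (cycleInclusion n b₁ b₂ m y) :=
      PreconnectedSpace.constant inferInstance (hf.comp (continuous_cycleInclusion m))
    have hnat (j : ℕ) : f (cycleInclusion n b₁ b₂ j b₁) = f (cycleInclusion n b₁ b₂ 0 b₁) := by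
      induction j with
      | zero => simp
      | succ j ih => rw [Nat.cast_succ, cycleInclusion_glue, hcopy _ b₂ b₁, ih]
    have hbase (a : Quot (cycleRel n R b₁ b₂)) : f a = f (cycleInclusion n b₁ b₂ 0 b₁) := by
      obtain ⟨m, x, rfl⟩ := exists_cycleInclusion_eq a
      rw [hcopy m x b₁, ← hnat m.val, ZMod.natCast_zmod_val]
    exact fun a b => (hbase a).trans (hbase b).symm
  exact ⟨⟨cycleInclusion n b₁ b₂ 0 b₁⟩⟩

/-- The `i` consecutive indices following `j`. -/
def cycleArc (j : ZMod n) (i : ℕ) : Set (ZMod n) := {k | (k - (j + 1)).val < i}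

theorem eq_of_mem_cycleArc_iff [NeZero n] (hn : 2 < n) {j k : ZMod n} {i : ℕ}
    (h : k ∈ cycleArc j i ↔ k + 1 ∉ cycleArc j i) (hk : k ≠ j) : k = j + i := by
  have : Fact (1 < n) := ⟨by omega⟩
  obtain ⟨d, rfl⟩ : ∃ d, k = d + (j + 1) := ⟨k - (j + 1), by ring⟩
  have hd : d.val + 1 < n := by
    by_contra hlt
    have hd' : d.val + 1 = n := by have := d.val_lt; omega
    apply hk
    have : d + 1 = 0 := by
      have h0 : ((d.val + 1 : ℕ) : ZMod n) = 0 := by rw [hd', ZMod.natCast_self]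
      simpa using h0
    linear_combination this
  have hd1 : (d + 1).val = d.val + 1 := by
    rw [ZMod.val_add_of_lt] <;> rw [ZMod.val_one]
    exact hd
  have e1 : d + (j + 1) - (j + 1) = d := by ring
  have e2 : d + (j + 1) + 1 - (j + 1) = d + 1 := by ring
  simp only [cycleArc, Set.mem_ofPred_eq, e1, e2, hd1] at h
  have hi : i = d.val + 1 := by omega
  rw [hi]
  push_cast
  rw [ZMod.natCast_zmod_val]
  ring

/-- An embedded copy of a rigid space that misses a gluing point lies in a single copy. -/
theorem exists_cyclePart_of_missing [NeZero n] (hn : 2 < n) [T1Space R] [PreconnectedSpace R]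
    (hrigid : ∀ f : R → R, Continuous f → f = id ∨ ∃ c, f = Function.const R c)
    (hb : b₁ ≠ b₂) {g : R → Quot (cycleRel n R b₁ b₂)} (hg : Continuous g)
    (hinj : Function.Injective g) {j : ZMod n} (hj : ∀ x, g x ≠ cycleInclusion n b₁ b₂ j b₂) :
    ∃ k, ∀ x, ∃ y, cycleInclusion n b₁ b₂ k y = g x := by
  classical
  have hbdry (i : ℕ) (x : R) (h : g x ∈ cyclePart b₁ b₂ (cycleArc j i))
      (h' : g x ∈ cyclePart b₁ b₂ (cycleArc j i)ᶜ) :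
      g x = cycleInclusion n b₁ b₂ (j + i) b₂ := by
    obtain ⟨k, hk, hkS⟩ := exists_of_mem_cyclePart_inter_compl hb h h'
    rwa [eq_of_mem_cycleArc_iff hn hkS fun e => hj x (e ▸ hk)] at hk
  have hdich (i : ℕ) : (∀ x, g x ∈ cyclePart b₁ b₂ (cycleArc j i)) ∨
      ∀ x, g x ∈ cyclePart b₁ b₂ (cycleArc j i)ᶜ := by
    rcases eq_univ_or_eq_univ_of_rigid hrigid
      ((isClosed_cyclePart hb (cycleArc j i)).preimage hg)
      ((isClosed_cyclePart hb (cycleArc j i)ᶜ).preimage hg)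
      (by rw [← Set.preimage_union, cyclePart_union_compl, Set.preimage_univ])
      (fun x hx y hy => hinj ((hbdry i x hx.1 hx.2).trans (hbdry i y hy.1 hy.2).symm)) with h | h
    · exact Or.inl fun x => Set.eq_univ_iff_forall.1 h x
    · exact Or.inr fun x => Set.eq_univ_iff_forall.1 h x
  have hex : ∃ i, ∀ x, g x ∈ cyclePart b₁ b₂ (cycleArc j i) := by
    refine ⟨n, fun x => ?_⟩
    obtain ⟨k, y, hy⟩ := exists_cycleInclusion_eq (g x)
    exact mem_cyclePart.2 ⟨k, ZMod.val_lt _, y, hy⟩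
  obtain ⟨i, hi, hmin⟩ : ∃ i, (∀ x, g x ∈ cyclePart b₁ b₂ (cycleArc j (i + 1))) ∧
      ¬ ∀ x, g x ∈ cyclePart b₁ b₂ (cycleArc j i) := by
    cases hfind : Nat.find hex with
    | zero =>
      obtain ⟨k, hk, -⟩ := mem_cyclePart.1 (Nat.find_spec hex b₁)
      rw [hfind] at hk
      exact absurd hk (Nat.not_lt_zero _)
    | succ i =>
      exact ⟨i, hfind ▸ Nat.find_spec hex, Nat.find_min hex (by omega)⟩
  refine ⟨j + 1 + i, fun x => ?_⟩
  obtain ⟨k, hk, y, hy⟩ := mem_cyclePart.1 (hi x)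
  by_cases hki : k ∈ cycleArc j i
  · refine ⟨b₁, ?_⟩
    rw [hbdry i x (mem_cyclePart.2 ⟨k, hki, y, hy⟩) ((hdich i).resolve_left hmin x),
      ← cycleInclusion_glue, add_right_comm]
  · have hval : (k - (j + 1)).val = i := by
      simp only [cycleArc, Set.mem_ofPred_eq] at hk hki
      omega
    refine ⟨y, ?_⟩
    rw [← hy, ← hval, ZMod.natCast_zmod_val, add_sub_cancel]

theorem exists_eq_cycleInclusion_of_missing [NeZero n] (hn : 2 < n) [T2Space R] [CompactSpace R]
    [PreconnectedSpace R]
    (hrigid : ∀ f : R → R, Continuous f → f = id ∨ ∃ c, f = Function.const R c)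
    (hb : b₁ ≠ b₂) {g : R → Quot (cycleRel n R b₁ b₂)} (hg : Continuous g)
    (hinj : Function.Injective g) {j : ZMod n} (hj : ∀ x, g x ≠ cycleInclusion n b₁ b₂ j b₂) :
    ∃ k, g = cycleInclusion n b₁ b₂ k := by
  have := t2Space_cycle (n := n) hb
  obtain ⟨k, hk⟩ := exists_cyclePart_of_missing hn hrigid hb hg hinj hj
  choose f hf using hk
  have hemb := (continuous_cycleInclusion k).isClosedEmbedding (cycleInclusion_injective hn hb k)
  have hfcont : Continuous f := by
    rw [hemb.isInducing.continuous_iff]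
    exact hg.congr fun x => (hf x).symm
  refine ⟨k, funext fun x => ?_⟩
  rcases hrigid f hfcont with rfl | ⟨c, rfl⟩
  · exact (hf x).symm
  · exact absurd (hinj ((hf b₁).symm.trans (hf b₂))) hb

theorem exists_comp_cycleInclusion_eq [NeZero n] (hn : 2 < n) [T2Space R] [CompactSpace R]
    [PreconnectedSpace R]
    (hrigid : ∀ f : R → R, Continuous f → f = id ∨ ∃ c, f = Function.const R c)
    (hb : b₁ ≠ b₂) (h : Quot (cycleRel n R b₁ b₂) ≃ₜ Quot (cycleRel n R b₁ b₂)) (m : ZMod n) :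
    ∃ k, ∀ x, h (cycleInclusion n b₁ b₂ m x) = cycleInclusion n b₁ b₂ k x := by
  have : Fact (1 < n) := ⟨by omega⟩
  have h2 : (2 : ZMod n) ≠ 0 := by
    intro h0
    have := (ZMod.natCast_eq_zero_iff 2 n).1 (by exact_mod_cast h0)
    have := Nat.le_of_dvd (by norm_num) this
    omega
  have hmiss (l : ZMod n)
      (hl : ¬ ∀ j, ∃ x, h (cycleInclusion n b₁ b₂ l x) = cycleInclusion n b₁ b₂ j b₂) :
      ∃ k, ∀ x, h (cycleInclusion n b₁ b₂ l x) = cycleInclusion n b₁ b₂ k x := by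
    push Not at hl
    obtain ⟨j, hj⟩ := hl
    obtain ⟨k, hk⟩ := exists_eq_cycleInclusion_of_missing hn hrigid hb
      (h.continuous.comp (continuous_cycleInclusion l))
      (h.injective.comp (cycleInclusion_injective hn hb l)) hj
    exact ⟨k, congrFun hk⟩
  refine hmiss m fun hall => ?_
  have hmeet {x y : R} (hxy : h (cycleInclusion n b₁ b₂ m x) =
      h (cycleInclusion n b₁ b₂ (m + 1) y)) : x = b₂ ∧ y = b₁ := by
    rcases (cycleInclusion_eq_iff hb).1 (h.injective hxy) with e | e | e
    · simp at e
    · refine absurd ?_ h2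
      linear_combination -e.1
    · exact ⟨e.2.2, e.2.1⟩
  by_cases hnext : ∀ j, ∃ x, h (cycleInclusion n b₁ b₂ (m + 1) x) = cycleInclusion n b₁ b₂ j b₂
  · have hconst (j : ZMod n) :
        h (cycleInclusion n b₁ b₂ m b₂) = cycleInclusion n b₁ b₂ j b₂ := by
      obtain ⟨x, hx⟩ := hall j
      obtain ⟨y, hy⟩ := hnext j
      rw [← hx, (hmeet (hx.trans hy.symm)).1]
    rcases (cycleInclusion_eq_iff hb).1 ((hconst 0).symm.trans (hconst 1)) with e | e | e
    · exact zero_ne_one e.1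
    · exact hb e.2.1.symm
    · exact hb e.2.1.symm
  · obtain ⟨k, hk⟩ := hmiss (m + 1) hnext
    obtain ⟨x, hx⟩ := hall k
    exact hb (hmeet (hx.trans (hk b₂).symm)).2.symm

theorem cycleRotationHom_bijective (hn : 2 < n) [T2Space R] [CompactSpace R]
    [PreconnectedSpace R]
    (hrigid : ∀ f : R → R, Continuous f → f = id ∨ ∃ c, f = Function.const R c)
    (hb : b₁ ≠ b₂) : Function.Bijective (cycleRotationHom n b₁ b₂) := by
  have : NeZero n := ⟨by omega⟩
  constructor
  · intro m k hmk
    have h : cycleInclusion n b₁ b₂ (m.toAdd + 0) b₁ = cycleInclusion n b₁ b₂ (k.toAdd + 0) b₁ :=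
      DFunLike.congr_fun hmk (cycleInclusion n b₁ b₂ 0 b₁)
    rcases (cycleInclusion_eq_iff hb).1 h with e | e | e
    · exact Multiplicative.toAdd.injective (by simpa using e.1)
    · exact absurd e.2.2 hb
    · exact absurd e.2.2 hb
  · intro h
    choose σ hσ using exists_comp_cycleInclusion_eq hn hrigid hb h
    have hsucc (m : ZMod n) : σ (m + 1) = σ m + 1 := by
      have hglue := congrArg h (cycleInclusion_glue (b₁ := b₁) (b₂ := b₂) m)
      rw [hσ, hσ] at hglue
      rcases (cycleInclusion_eq_iff hb).1 hglue with e | e | e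
      · exact absurd e.2 hb
      · exact e.1
      · exact absurd e.2.2 hb
    refine ⟨Multiplicative.ofAdd (σ 0), Homeomorph.ext fun a => ?_⟩
    obtain ⟨m, x, rfl⟩ := exists_cycleInclusion_eq a
    rw [hσ, ZMod.forall_eq_add_of_succ hsucc m]
    rfl

end CycleRealisation

/-- Example 2.7(i): the realisation of the `n`-cycle via a doubly pointed de Groot
continuum is a compact connected Hausdorff space whose full homeomorphism group is
the cyclic group `ℤ/nℤ`, acting by translation of the first coordinate. -/
theorem cycle_realisation_homeo_group
    (n : ℕ) (hn : 2 < n) (R : Type) [MetricSpace R] [CompactSpace R]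
    [ConnectedSpace R] [Nonempty R]
    (hrigid : ∀ f : R → R, Continuous f → f = id ∨ ∃ c, f = Function.const R c)
    (b₁ b₂ : R) (hb : b₁ ≠ b₂) :
    CompactSpace (Quot (cycleRel n R b₁ b₂)) ∧
    ConnectedSpace (Quot (cycleRel n R b₁ b₂)) ∧
    T2Space (Quot (cycleRel n R b₁ b₂)) ∧
    ∃ e : Multiplicative (ZMod n) ≃*
        (Quot (cycleRel n R b₁ b₂) ≃ₜ Quot (cycleRel n R b₁ b₂)),
      ∀ (m k : ZMod n) (x : R),
        e (Multiplicative.ofAdd m) (Quot.mk (cycleRel n R b₁ b₂) (k, x)) =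
          Quot.mk (cycleRel n R b₁ b₂) (m + k, x) := by
  have : NeZero n := ⟨by omega⟩
  exact ⟨Quot.compactSpace, connectedSpace_cycle, t2Space_cycle hb,
    MulEquiv.ofBijective (cycleRotationHom n b₁ b₂) (cycleRotationHom_bijective hn hrigid hb),
    fun _ _ _ => rfl⟩
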